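/- arXiv:1201.4632 — 3 statements merged into one kernel-verified Lean document; each statement's English description precedes it below -/
import Mathlib

section
/- Let X be an n×n matrix with all entries positive (n ≥ 2), let v_k denote a Perron (principal) eigenvector of the k-th Hadamard power X^{(k)} = [X_{ij}^k] for k > 0, and let h(X)_i = (∏_{j=1}^n X_{ij})^{1/n} be the row geometric mean vector. Then for every pair of indices i, j, the ratio (v_k(i)/v_k(j))^{1/k} converges to h(X)_i / h(X)_j as k → 0⁺. (Equivalently, v(X^{(k)})^{1/k} converges to h(X) as a point of projective space.) -/
open Filter Topology

theorem tendsto_rpow_sub_one_div {x : ℝ} (hx : 0 < x) :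
    Tendsto (fun k : ℝ => (x ^ k - 1) / k) (𝓝[>] 0) (𝓝 (Real.log x)) := by
  have h : HasDerivAt (fun k : ℝ => x ^ k) (Real.log x) 0 := by
    simpa using (hasDerivAt_id (0 : ℝ)).const_rpow hx
  have h2 := (hasDerivAt_iff_tendsto_slope.1 h).mono_left
    (nhdsWithin_mono (0 : ℝ) (fun k (hk : 0 < k) => hk.ne'))
  refine h2.congr fun k => ?_
  simp [slope_def_field]

/-- A function with first-order expansion `1 + L k` at `0⁺` has logarithm `L k` to first order. -/
theorem tendsto_log_div_of_tendsto_sub_one_div {F : ℝ → ℝ} {L : ℝ}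
    (h : Tendsto (fun k => (F k - 1) / k) (𝓝[>] 0) (𝓝 L)) :
    Tendsto (fun k => Real.log (F k) / k) (𝓝[>] 0) (𝓝 L) := by
  have hid : Tendsto (fun k : ℝ => k) (𝓝[>] 0) (𝓝 0) := nhdsWithin_le_nhds
  have hF : Tendsto F (𝓝[>] 0) (𝓝 1) := by
    have h1 := (h.mul hid).add_const 1
    rw [mul_zero, zero_add] at h1
    refine h1.congr' ?_
    filter_upwards [self_mem_nhdsWithin] with k hk
    rw [div_mul_cancel₀ _ (ne_of_gt hk), sub_add_cancel]
  have hlow : Tendsto (fun k => (F k - 1) / k / F k) (𝓝[>] 0) (𝓝 L) := by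
    simpa [Pi.div_def] using h.div hF one_ne_zero
  have hFpos : ∀ᶠ k in 𝓝[>] (0 : ℝ), 0 < F k := hF.eventually (lt_mem_nhds one_pos)
  refine tendsto_of_tendsto_of_tendsto_of_le_of_le' hlow h ?_ ?_
  · filter_upwards [self_mem_nhdsWithin, hFpos] with k hk hp
    have h1 := Real.one_sub_inv_le_log_of_pos hp
    have h2 : (F k - 1) / k / F k = (1 - (F k)⁻¹) / k := by
      have : k ≠ 0 := ne_of_gt hk
      field_simp
    rw [h2]
    exact div_le_div_of_nonneg_right h1 (le_of_lt hk)
  · filter_upwards [self_mem_nhdsWithin, hFpos] with k hk hp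
    exact div_le_div_of_nonneg_right (Real.log_le_sub_one_of_pos hp) (le_of_lt hk)

/-- **Theorem (HodgeRank is the limit of Perron Rank).**
Let `X` be an `n × n` matrix with positive entries (`n ≥ 2`).  For `k > 0` let `v k` be any
Perron (entrywise-positive principal) eigenvector of the Hadamard power `X^(k) = [X i j ^ k]`,
with eigenvalue `lam k`, and let `h i = (∏ j, X i j) ^ (1/n)` be the row geometric mean.
Then for all indices `i, j`, `(v k i / v k j) ^ (1/k) → h i / h j` as `k → 0⁺`. -/
theorem perron_rank_tendsto_hodge_rank
    (n : ℕ) (hn : 2 ≤ n)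
    (X : Matrix (Fin n) (Fin n) ℝ) (hX : ∀ i j, 0 < X i j)
    (v : ℝ → Fin n → ℝ) (lam : ℝ → ℝ)
    (hpos : ∀ k, 0 < k → ∀ i, 0 < v k i)
    (heig : ∀ k, 0 < k →
      (Matrix.of fun i j => X i j ^ k).mulVec (v k) = lam k • v k) :
    ∀ i j : Fin n,
      Tendsto (fun k : ℝ => (v k i / v k j) ^ (1 / k))
        (nhdsWithin 0 (Set.Ioi 0))
        (nhds ((∏ l, X i l) ^ ((1 : ℝ) / n) / (∏ l, X j l) ^ ((1 : ℝ) / n))) := by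
  have hn0 : (n : ℝ) ≠ 0 := by
    have : n ≠ 0 := by omega
    exact_mod_cast this
  have : Nonempty (Fin n) := ⟨⟨0, by omega⟩⟩
  set w : ℝ → Fin n → ℝ := fun k i => v k i / ∑ l, v k l with hw
  set F : Fin n → ℝ → ℝ := fun i k => ∑ l, w k l * X i l ^ k with hF
  have hsum : ∀ k, 0 < k → 0 < ∑ l, v k l := fun k hk =>
    Finset.sum_pos (fun l _ => hpos k hk l) Finset.univ_nonempty
  have hwpos : ∀ k, 0 < k → ∀ i, 0 < w k i := fun k hk i => div_pos (hpos k hk i) (hsum k hk)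
  have hwsum : ∀ k, 0 < k → ∑ i, w k i = 1 := fun k hk => by
    rw [hw, ← Finset.sum_div, div_self (hsum k hk).ne']
  have hwle : ∀ k, 0 < k → ∀ i, w k i ≤ 1 := fun k hk i => by
    rw [← hwsum k hk]
    exact Finset.single_le_sum (fun l _ => (hwpos k hk l).le) (Finset.mem_univ i)
  have hFpos : ∀ k, 0 < k → ∀ i, 0 < F i k := fun k hk i =>
    Finset.sum_pos (fun l _ => mul_pos (hwpos k hk l) (Real.rpow_pos_of_pos (hX i l) k))
      Finset.univ_nonempty
  have hFeig : ∀ k, 0 < k → ∀ i, F i k = lam k * w k i := fun k hk i => by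
    have h := congrFun (heig k hk) i
    simp only [Matrix.mulVec, dotProduct, Matrix.of_apply, Pi.smul_apply, smul_eq_mul] at h
    simp only [hF, hw]
    rw [← mul_div_assoc, ← h, Finset.sum_div]
    exact Finset.sum_congr rfl fun l _ => by ring
  have hFsub : ∀ k, 0 < k → ∀ i, F i k - 1 = ∑ l, w k l * (X i l ^ k - 1) := fun k hk i => by
    simp only [hF, mul_sub, mul_one, Finset.sum_sub_distrib, hwsum k hk]
  have hXk : ∀ i l, Tendsto (fun k : ℝ => X i l ^ k - 1) (𝓝[>] 0) (𝓝 0) := fun i l => by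
    have h : ContinuousAt (fun k : ℝ => X i l ^ k) 0 :=
      Real.continuousAt_const_rpow (hX i l).ne'
    have h1 := (h.tendsto.mono_left (nhdsWithin_le_nhds (s := Set.Ioi 0))).sub_const 1
    simpa using h1
  have hF1 : ∀ i, Tendsto (F i) (𝓝[>] 0) (𝓝 1) := fun i => by
    have h : Tendsto (fun k => F i k - 1) (𝓝[>] 0) (𝓝 0) := by
      have hb : Tendsto (fun k : ℝ => ∑ l, |X i l ^ k - 1|) (𝓝[>] 0) (𝓝 0) := by
        simpa using tendsto_finsetSum Finset.univ fun l _ => (hXk i l).abs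
      refine squeeze_zero_norm' ?_ hb
      filter_upwards [self_mem_nhdsWithin] with k hk
      rw [hFsub k hk i, Real.norm_eq_abs]
      refine (Finset.abs_sum_le_sum_abs _ _).trans (Finset.sum_le_sum fun l _ => ?_)
      rw [abs_mul, abs_of_pos (hwpos k hk l)]
      exact mul_le_of_le_one_left (abs_nonneg _) (hwle k hk l)
    simpa using h.add_const 1
  have hlam : Tendsto lam (𝓝[>] 0) (𝓝 n) := by
    have h : Tendsto (fun k => ∑ i, F i k) (𝓝[>] 0) (𝓝 n) := by
      simpa using tendsto_finsetSum Finset.univ fun i _ => hF1 i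
    refine h.congr' ?_
    filter_upwards [self_mem_nhdsWithin] with k hk
    rw [Finset.sum_congr rfl fun i _ => hFeig k hk i, ← Finset.mul_sum, hwsum k hk, mul_one]
  have hlam0 : ∀ k, 0 < k → lam k ≠ 0 := fun k hk h0 => by
    have h := hFpos k hk ⟨0, by omega⟩
    rw [hFeig k hk, h0, zero_mul] at h
    exact h.false
  have hwlim : ∀ i, Tendsto (fun k => w k i) (𝓝[>] 0) (𝓝 (1 / n)) := fun i => by
    refine ((hF1 i).div hlam hn0).congr' ?_
    filter_upwards [self_mem_nhdsWithin] with k hk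
    rw [Pi.div_apply, hFeig k hk, mul_div_cancel_left₀ _ (hlam0 k hk)]
  have hlog : ∀ i, Tendsto (fun k => Real.log (F i k) / k) (𝓝[>] 0)
      (𝓝 (∑ l, 1 / (n : ℝ) * Real.log (X i l))) := fun i => by
    refine tendsto_log_div_of_tendsto_sub_one_div ?_
    refine (tendsto_finsetSum Finset.univ fun l _ =>
      (hwlim l).mul (tendsto_rpow_sub_one_div (hX i l))).congr' ?_
    filter_upwards [self_mem_nhdsWithin] with k hk
    rw [hFsub k hk, Finset.sum_div]
    exact Finset.sum_congr rfl fun l _ => (mul_div_assoc _ _ _).symm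
  have hh : ∀ i, (∏ l, X i l) ^ ((1 : ℝ) / n) =
      Real.exp (∑ l, 1 / (n : ℝ) * Real.log (X i l)) := fun i => by
    rw [Real.rpow_def_of_pos (Finset.prod_pos fun l _ => hX i l),
      Real.log_prod fun l _ => (hX i l).ne', ← Finset.mul_sum, mul_comm]
  intro i j
  rw [hh, hh, ← Real.exp_sub]
  refine ((Real.continuous_exp.tendsto _).comp ((hlog i).sub (hlog j))).congr' ?_
  filter_upwards [self_mem_nhdsWithin] with k hk
  have hratio : v k i / v k j = F i k / F j k := by
    rw [hFeig k hk, hFeig k hk, mul_div_mul_left _ _ (hlam0 k hk)]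
    exact (div_div_div_cancel_right₀ (hsum k hk).ne' _ _).symm
  rw [hratio, Real.rpow_def_of_pos (div_pos (hFpos k hk i) (hFpos k hk j)),
    Real.log_div (hFpos k hk i).ne' (hFpos k hk j).ne', Function.comp_apply]
  congr 1
  ring
end

section
/- Fix n ≥ 2 and for k > 0 let T_k := {b ∈ ℝ^n : ∑_{j=1}^n exp(k·b_j) = n} and H := {b ∈ ℝ^n : ∑_{j=1}^n b_j = 0}. Then T_k converges to the hyperplane H as k → 0⁺ in the following sense: (i) for every b ∈ H there exist b_k ∈ T_k with b_k → b as k → 0⁺; (ii) if b_k ∈ T_k for a sequence k → 0⁺ and b_k → b, then b ∈ H. (T_k is the translate by ((log n)/k)·𝟙 of the surface S(k) = {a : a_j < 0, ∑_j exp(k·a_j) = 1}, so this says that each component S_i(k) of the zero-fiber of the Perron family, after translation by a multiple of the all-ones vector, converges to its tangent plane ∑_j a_{ij} = 0, the corresponding component of the HodgeRank zero-fiber.) -/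
open Filter Topology

/-- If `k → 0` through nonzero values and `f → L`, then `(exp (k * f) - 1) / k → L`. -/
theorem tendsto_exp_mul_sub_one_div {α : Type*} {l : Filter α} {k f : α → ℝ} {L : ℝ}
    (hk0 : ∀ a, k a ≠ 0) (hk : Tendsto k l (𝓝 0)) (hf : Tendsto f l (𝓝 L)) :
    Tendsto (fun a => (Real.exp (k a * f a) - 1) / k a) l (𝓝 L) := by
  have hg : Tendsto (dslope Real.exp 0) (𝓝 0) (𝓝 1) := by
    have h := (continuousAt_dslope_same.2 (Real.differentiable_exp 0)).tendsto
    simpa [dslope_same] using h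
  have hkf : Tendsto (fun a => k a * f a) l (𝓝 0) := by simpa using hk.mul hf
  have h := hf.mul (hg.comp hkf)
  rw [mul_one] at h
  refine h.congr fun a => ?_
  have hs := sub_smul_dslope Real.exp 0 (k a * f a)
  simp only [sub_zero, smul_eq_mul, Real.exp_zero] at hs
  rw [eq_div_iff (hk0 a), ← hs, Function.comp_apply]
  ring

/-- If `∑ j, b j = 0`, the logarithm of the average of `exp (k * b j)` is `o(k)` as `k → 0⁺`. -/
theorem tendsto_log_average_exp_div {n : ℕ} (hn : n ≠ 0) {b : Fin n → ℝ} (hb : ∑ j, b j = 0) :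
    Tendsto (fun k : ℝ => Real.log ((∑ j, Real.exp (k * b j)) / n) / k) (𝓝[>] 0) (𝓝 0) := by
  have hn' : (n : ℝ) ≠ 0 := Nat.cast_ne_zero.2 hn
  have hsum : HasDerivAt (fun k : ℝ => ∑ j, Real.exp (k * b j)) (∑ j, b j) 0 := by
    refine HasDerivAt.fun_sum fun j _ => ?_
    simpa using ((hasDerivAt_id (0 : ℝ)).mul_const (b j)).exp
  have hlog := (hsum.div_const (n : ℝ)).log (by simp [hn'])
  rw [hb] at hlog
  have h := hlog.tendsto_slope_zero_right
  simp only [zero_add, zero_mul, Real.exp_zero, Finset.sum_const, Finset.card_univ,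
    Fintype.card_fin, nsmul_eq_mul, mul_one, div_self hn', Real.log_one, sub_zero, zero_div,
    smul_eq_mul] at h
  exact h.congr fun k => inv_mul_eq_div _ _

/-- **Lemma (the Perron-family fiber components flatten to the HodgeRank hyperplane).**
Fix `n ≥ 2` and for `k > 0` let `T k = {b : ∑ j, exp (k·b j) = n}` (the translate of the
zero-fiber component `S(k)` by `((log n)/k)·𝟙`) and `H = {b : ∑ j, b j = 0}`.  Then `T k`
converges to `H` as `k → 0⁺`: (i) every `b ∈ H` is the limit as `k → 0⁺` of points
`b_k ∈ T k`; (ii) any limit of points `b_m ∈ T (k m)` along a sequence `k m → 0⁺` lies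
in `H`. -/
theorem perron_fiber_component_tendsto_hodge_hyperplane
    (n : ℕ) (hn : 2 ≤ n) :
    (∀ b : Fin n → ℝ, (∑ j, b j = 0) →
      ∃ bk : ℝ → Fin n → ℝ,
        (∀ k : ℝ, 0 < k → ∑ j, Real.exp (k * bk k j) = (n : ℝ)) ∧
        Tendsto bk (nhdsWithin 0 (Set.Ioi 0)) (nhds b)) ∧
    (∀ (k : ℕ → ℝ) (bk : ℕ → Fin n → ℝ) (b : Fin n → ℝ),
      (∀ m, 0 < k m) → Tendsto k atTop (nhds 0) →
      (∀ m, ∑ j, Real.exp (k m * bk m j) = (n : ℝ)) →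
      Tendsto bk atTop (nhds b) →
      ∑ j, b j = 0) := by
  have hn0 : n ≠ 0 := by omega
  have hn' : (0 : ℝ) < n := Nat.cast_pos.2 (Nat.pos_of_ne_zero hn0)
  have : Nonempty (Fin n) := ⟨⟨0, Nat.pos_of_ne_zero hn0⟩⟩
  refine ⟨fun b hb => ?_, fun k bk b hk0 hk hbk hlim => ?_⟩
  · refine ⟨fun k j => b j - Real.log ((∑ i, Real.exp (k * b i)) / n) / k, fun k hk => ?_, ?_⟩
    · have hpos : 0 < ∑ i, Real.exp (k * b i) :=
        Finset.sum_pos (fun i _ => Real.exp_pos _) Finset.univ_nonempty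
      simp only [mul_sub, mul_div_cancel₀ _ hk.ne', Real.exp_sub,
        Real.exp_log (div_pos hpos hn'), ← Finset.sum_div]
      field_simp
    · refine tendsto_pi_nhds.2 fun j => ?_
      simpa using (tendsto_log_average_exp_div hn0 hb).const_sub (b j)
  · have h : Tendsto (fun m => ∑ j, (Real.exp (k m * bk m j) - 1) / k m) atTop (𝓝 (∑ j, b j)) :=
      tendsto_finsetSum _ fun j _ =>
        tendsto_exp_mul_sub_one_div (fun m => (hk0 m).ne') hk (tendsto_pi_nhds.1 hlim j)
    refine tendsto_nhds_unique h (tendsto_const_nhds.congr fun m => ?_)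
    simp [← Finset.sum_div, Finset.sum_sub_distrib, hbk m]
end

section
/- Fix n ≥ 2 and an n×n matrix A ∈ ℝ^{n×n}, and set X_{ij} = exp(A_{ij}) (so X has positive entries). For k > 0 let v_k denote the Perron eigenvector of X^{(k)} = [exp(k·A_{ij})], normalized so that ∑_i log v_k(i) = 0. Then lim_{k→0⁺} (1/k)·log v_k = (1/n)·A𝟙 − (1/n²)·(𝟙ᵀA𝟙)·𝟙 in ℝ^n, where 𝟙 is the all-ones vector; i.e., the rescaled log-Perron vector converges to the centered vector of row averages of A (the additive HodgeRank score of A). -/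
open Filter Topology

/-- Entries of a positive eigenvector of `[exp (k * A i j)]` have log-ratios at most `2 * k * M`
when the entries of `A` are bounded by `M`. -/
lemma log_sub_log_le_of_eigenvector {n : ℕ} {A : Matrix (Fin n) (Fin n) ℝ} {M k lam : ℝ}
    {v : Fin n → ℝ} (hM : ∀ i j, |A i j| ≤ M) (hk : 0 < k) (hpos : ∀ i, 0 < v i)
    (heig : ∀ i, ∑ j, Real.exp (k * A i j) * v j = lam * v i) (i j : Fin n) :
    Real.log (v i) - Real.log (v j) ≤ 2 * k * M := by
  have hlam : 0 < lam := by
    have h : 0 < lam * v i := by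
      rw [← heig i]
      exact Finset.sum_pos (fun p _ => mul_pos (Real.exp_pos _) (hpos p)) ⟨i, Finset.mem_univ i⟩
    exact pos_of_mul_pos_left h (hpos i).le
  have hle : lam * v i ≤ lam * (Real.exp (2 * k * M) * v j) := by
    calc lam * v i = ∑ p, Real.exp (k * A i p) * v p := (heig i).symm
      _ ≤ ∑ p, Real.exp (2 * k * M) * (Real.exp (k * A j p) * v p) := by
        refine Finset.sum_le_sum fun p _ => ?_
        rw [← mul_assoc, ← Real.exp_add]
        refine mul_le_mul_of_nonneg_right (Real.exp_le_exp.2 ?_) (hpos p).le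
        have h1 := (abs_le.1 (hM i p)).2
        have h2 := (abs_le.1 (hM j p)).1
        nlinarith
      _ = lam * (Real.exp (2 * k * M) * v j) := by
        rw [← Finset.mul_sum, heig j]; ring
  have h := Real.log_le_log (hpos i) (le_of_mul_le_mul_left hle hlam)
  rw [Real.log_mul (Real.exp_pos _).ne' (hpos j).ne', Real.log_exp] at h
  linarith

/-- Quantitative form of the limit: the rescaled log-Perron vector differs from the centered
vector of row averages by `O(k)`. -/
lemma abs_log_div_sub_centered_row_average_le {n : ℕ} {A : Matrix (Fin n) (Fin n) ℝ}
    {M k lam : ℝ} {v : Fin n → ℝ} (hn : 0 < n) (hM : ∀ i j, |A i j| ≤ M) (hk : 0 < k)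
    (hkM : k * (3 * M) ≤ 1) (hpos : ∀ i, 0 < v i)
    (heig : ∀ i, ∑ j, Real.exp (k * A i j) * v j = lam * v i)
    (hnorm : ∑ i, Real.log (v i) = 0) (i : Fin n) :
    |(1 / k) * Real.log (v i) - ((1 / (n : ℝ)) * ∑ j, A i j
      - (1 / (n : ℝ) ^ 2) * ∑ p, ∑ q, A p q)| ≤ 2 * k * (3 * M) ^ 2 := by
  have hn' : (0 : ℝ) < n := by exact_mod_cast hn
  set x : Fin n → Fin n → ℝ := fun p q => k * A p q + Real.log (v q) - Real.log (v p) with hx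
  have hxabs (p q : Fin n) : |x p q| ≤ k * (3 * M) := by
    have h1 := abs_le.1 (hM p q)
    have h2 := log_sub_log_le_of_eigenvector hM hk hpos heig p q
    have h3 := log_sub_log_le_of_eigenvector hM hk hpos heig q p
    rw [abs_le]
    constructor <;> simp only [hx] <;> nlinarith
  have hlam (p : Fin n) : ∑ q, Real.exp (x p q) = lam := by
    have h : ∑ q, Real.exp (x p q) = (∑ q, Real.exp (k * A p q) * v q) / v p := by
      rw [Finset.sum_div]
      refine Finset.sum_congr rfl fun q _ => ?_
      rw [Real.exp_sub, Real.exp_add, Real.exp_log (hpos q), Real.exp_log (hpos p)]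
    rw [h, heig p, mul_div_cancel_right₀ _ (hpos p).ne']
  have hrow (p : Fin n) : |lam - (n + k * ∑ q, A p q - n * Real.log (v p))|
      ≤ n * (k * (3 * M)) ^ 2 := by
    have h : lam - (n + k * ∑ q, A p q - n * Real.log (v p))
        = ∑ q, (Real.exp (x p q) - 1 - x p q) := by
      simp only [Finset.sum_sub_distrib, hlam]
      simp only [hx, Finset.sum_sub_distrib, Finset.sum_add_distrib, hnorm,
        ← Finset.mul_sum, Finset.sum_const, Finset.card_univ, Fintype.card_fin, nsmul_eq_mul]
      ring
    rw [h]
    calc |∑ q, (Real.exp (x p q) - 1 - x p q)|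
        ≤ ∑ q, |Real.exp (x p q) - 1 - x p q| := Finset.abs_sum_le_sum_abs _ _
      _ ≤ ∑ _q : Fin n, (k * (3 * M)) ^ 2 := by
        refine Finset.sum_le_sum fun q _ => ?_
        refine (Real.abs_exp_sub_one_sub_id_le ((hxabs p q).trans hkM)).trans ?_
        rw [← sq_abs]
        exact pow_le_pow_left₀ (abs_nonneg _) (hxabs p q) 2
      _ = n * (k * (3 * M)) ^ 2 := by simp
  have htot : |n * lam - (n * n + k * ∑ p, ∑ q, A p q)| ≤ n * (n * (k * (3 * M)) ^ 2) := by
    have h : n * lam - (n * n + k * ∑ p, ∑ q, A p q)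
        = ∑ p, (lam - (n + k * ∑ q, A p q - n * Real.log (v p))) := by
      simp only [Finset.sum_sub_distrib, Finset.sum_add_distrib, hnorm,
        ← Finset.mul_sum, Finset.sum_const, Finset.card_univ, Fintype.card_fin, nsmul_eq_mul]
      ring
    rw [h]
    calc _ ≤ ∑ p, |lam - (n + k * ∑ q, A p q - n * Real.log (v p))| :=
          Finset.abs_sum_le_sum_abs _ _
      _ ≤ ∑ _p : Fin n, n * (k * (3 * M)) ^ 2 := Finset.sum_le_sum fun p _ => hrow p
      _ = n * (n * (k * (3 * M)) ^ 2) := by simp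
  have hc : 0 < k * (n : ℝ) ^ 2 := by positivity
  refine le_of_mul_le_mul_left ?_ hc
  rw [← abs_of_pos hc, ← abs_mul, abs_of_pos hc]
  have hdiff : k * (n : ℝ) ^ 2 * ((1 / k) * Real.log (v i) - ((1 / (n : ℝ)) * ∑ j, A i j
      - (1 / (n : ℝ) ^ 2) * ∑ p, ∑ q, A p q))
      = n * (lam - (n + k * ∑ q, A i q - n * Real.log (v i)))
        - (n * lam - (n * n + k * ∑ p, ∑ q, A p q)) := by
    field_simp
    ring
  rw [hdiff]
  refine (abs_sub _ _).trans ?_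
  rw [abs_mul, abs_of_pos hn']
  have h := mul_le_mul_of_nonneg_left (hrow i) hn'.le
  linarith

/-- **Theorem (additive form of the HodgeRank limit of Perron Rank).**
Fix `n ≥ 2` and `A ∈ ℝ^{n×n}`, and set `X i j = exp (A i j)`.  For `k > 0` let `v k` be
the Perron (positive) eigenvector of `X^(k) = [exp (k·A i j)]` normalized so that
`∑ i, log (v k i) = 0`.  Then, as `k → 0⁺`, `(1/k)·log (v k)` converges (coordinatewise)
to `(1/n)·A𝟙 - (1/n²)·(𝟙ᵀA𝟙)·𝟙`, the centered vector of row averages of `A`. -/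
theorem log_perron_tendsto_centered_row_averages
    (n : ℕ) (hn : 2 ≤ n)
    (A : Matrix (Fin n) (Fin n) ℝ)
    (v : ℝ → Fin n → ℝ) (lam : ℝ → ℝ)
    (hpos : ∀ k, 0 < k → ∀ i, 0 < v k i)
    (heig : ∀ k, 0 < k →
      (Matrix.of fun i j => Real.exp (k * A i j)).mulVec (v k) = lam k • v k)
    (hnorm : ∀ k, 0 < k → ∑ i, Real.log (v k i) = 0) :
    ∀ i : Fin n,
      Tendsto (fun k : ℝ => (1 / k) * Real.log (v k i))
        (nhdsWithin 0 (Set.Ioi 0))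
        (nhds ((1 / (n : ℝ)) * ∑ j, A i j
          - (1 / (n : ℝ) ^ 2) * ∑ p, ∑ q, A p q)) := by
  intro i
  set M : ℝ := ∑ p, ∑ q, |A p q| with hMdef
  have hM (p q : Fin n) : |A p q| ≤ M :=
    (Finset.single_le_sum (f := fun q => |A p q|) (fun _ _ => abs_nonneg _)
      (Finset.mem_univ q)).trans
      (Finset.single_le_sum (f := fun p => ∑ q, |A p q|)
        (fun _ _ => Finset.sum_nonneg fun _ _ => abs_nonneg _) (Finset.mem_univ p))
  have hsmall : ∀ᶠ k : ℝ in 𝓝[>] 0, k * (3 * M) ≤ 1 := by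
    have h : Tendsto (fun k : ℝ => k * (3 * M)) (𝓝[>] 0) (𝓝 0) :=
      tendsto_nhdsWithin_of_tendsto_nhds (Continuous.tendsto' (by fun_prop) _ _ (by simp))
    exact h.eventually_le_const one_pos
  have hbound : Tendsto (fun k : ℝ => 2 * k * (3 * M) ^ 2) (𝓝[>] 0) (𝓝 0) :=
    tendsto_nhdsWithin_of_tendsto_nhds (Continuous.tendsto' (by fun_prop) _ _ (by simp))
  rw [tendsto_iff_norm_sub_tendsto_zero]
  refine squeeze_zero' (Eventually.of_forall fun _ => norm_nonneg _) ?_ hbound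
  filter_upwards [hsmall, self_mem_nhdsWithin] with k hkM hk
  refine abs_log_div_sub_centered_row_average_le (lam := lam k) (by omega) hM hk hkM (hpos k hk)
    (fun p => ?_) (hnorm k hk) i
  simpa [Matrix.mulVec, dotProduct] using congrFun (heig k hk) p
end
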